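/- Let N = (V, E, ω) be a phylogenetic X-network with an edge coloring c : E → {1,…,N₀}, fix an enumeration x₁,…,xₙ of X, let F = (X, E_F, γ) be a food web on X, and let k, D ∈ ℕ. If (A, χ₁, χ₂) is a perfect triple such that X \ A is γ-viable, |A| ≥ |X| − k, and Σ_{x∈A} ω(F_{x,χ₂(x)}) ≤ ω(E) − D (where F_{x,χ₂(x)} is the unique (x,χ₂(x))-respecting set witnessing perfection), then the set S := X \ A is γ-viable, has |S| ≤ k, and satisfies PD_N(S) ≥ D. -/

import Mathlib

attribute [local instance] Classical.propDecidable

noncomputable section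

/-- A phylogenetic network on the vertex type `V`: a finite DAG with positive
integer edge weights, a unique in-degree-0 vertex (the root), in which every
non-root vertex is a leaf (taxon), a tree vertex, or a reticulation. -/
structure PhyloNetwork (V : Type*) [Fintype V] [DecidableEq V] where
  E : Finset (V × V)
  ω : V × V → ℕ
  ω_pos : ∀ e ∈ E, 0 < ω e
  acyclic : ∀ v : V, ¬ Relation.TransGen (fun a b : V => (a, b) ∈ E) v v
  root : V
  root_indeg : ∀ e ∈ E, e.2 ≠ root
  root_unique : ∀ v : V, (∀ e ∈ E, e.2 ≠ v) → v = root
  classify : ∀ v : V, v = root ∨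
      ((E.filter (fun e => e.2 = v)).card = 1 ∧ (E.filter (fun e => e.1 = v)).card = 0) ∨
      ((E.filter (fun e => e.2 = v)).card = 1 ∧ 2 ≤ (E.filter (fun e => e.1 = v)).card) ∨
      ((E.filter (fun e => e.1 = v)).card = 1 ∧ 2 ≤ (E.filter (fun e => e.2 = v)).card)

/-- Reachability by a directed path that uses only edges from `F`. -/
def ReachVia {V : Type*} (F : Finset (V × V)) (u v : V) : Prop :=
  Relation.ReflTransGen (fun a b : V => (a, b) ∈ F) u v

namespace PhyloNetwork

variable {V : Type*} [Fintype V] [DecidableEq V]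

/-- A leaf (taxon): in-degree 1 and out-degree 0. -/
def IsLeaf (N : PhyloNetwork V) (v : V) : Prop :=
  (N.E.filter (fun e => e.2 = v)).card = 1 ∧ (N.E.filter (fun e => e.1 = v)).card = 0

/-- A tree vertex: in-degree 1 and out-degree at least 2. -/
def IsTreeVertex (N : PhyloNetwork V) (v : V) : Prop :=
  (N.E.filter (fun e => e.2 = v)).card = 1 ∧ 2 ≤ (N.E.filter (fun e => e.1 = v)).card

/-- A reticulation: out-degree 1 and in-degree at least 2. -/
def IsReticulation (N : PhyloNetwork V) (v : V) : Prop :=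
  (N.E.filter (fun e => e.1 = v)).card = 1 ∧ 2 ≤ (N.E.filter (fun e => e.2 = v)).card

/-- `off v`: the set of leaves reachable from `v` by a directed path. -/
def off (N : PhyloNetwork V) (v : V) : Set V :=
  {x | N.IsLeaf x ∧ ReachVia N.E v x}

/-- Total weight of a set of edges. -/
def weight (N : PhyloNetwork V) (F : Finset (V × V)) : ℕ := ∑ e ∈ F, N.ω e

/-- Total weight of all edges of the network. -/
def totalWeight (N : PhyloNetwork V) : ℕ := N.weight N.E

/-- `E(S)`: the edges `uv` with `off v ∩ S ≠ ∅`. -/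
def edgesTo (N : PhyloNetwork V) (S : Set V) : Finset (V × V) :=
  N.E.filter (fun e => ∃ x ∈ N.off e.2, x ∈ S)

/-- The (all-paths) phylogenetic diversity of a set `S` of taxa. -/
def PD (N : PhyloNetwork V) (S : Set V) : ℕ := N.weight (N.edgesTo S)

end PhyloNetwork

namespace PhyloNetwork

variable {V : Type*} [Fintype V] [DecidableEq V]

/-- `F` is an `(x, C)`-respecting set of edges for the coloring `c`. -/
def IsRespecting (N : PhyloNetwork V) (c : V × V → ℕ) (C : Finset ℕ) (x : V)
    (F : Finset (V × V)) : Prop :=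
  F ⊆ N.E ∧
  (∀ e ∈ N.E, e.2 = x → e ∈ F) ∧
  (∀ e ∈ F, c e ∉ C) ∧
  (∀ e ∈ F, ReachVia F e.2 x) ∧
  ∃ F' : Finset (V × V), F' ⊆ N.E ∧
    (∀ e ∈ F', c e ∈ C) ∧
    (∀ e₁ ∈ F ∪ F', ∀ e₂ ∈ F ∪ F', c e₁ = c e₂ → e₁ = e₂) ∧
    ∀ e ∈ F, Xor'
      ((∀ e' ∈ N.E, e'.2 = e.1 → e' ∈ F) ∧ (∀ e' ∈ N.E, e'.1 = e.1 → c e' ∉ C))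
      ((∀ e' ∈ F, e'.2 ≠ e.1) ∧ ∃ e' ∈ F', e'.1 = e.1 ∧ c e' ∈ C)

end PhyloNetwork

namespace PhyloNetwork

variable {V : Type*} [Fintype V] [DecidableEq V]

/-- `(A, χ₁, χ₂)` is a perfect triple relative to the enumeration `xs` of the taxa,
with `Fx i` the `(xs i, χ₂ i)`-respecting set witnessing the last condition. -/
def IsPerfect (N : PhyloNetwork V) (c : V × V → ℕ) {n : ℕ} (xs : Fin n → V)
    (A : Finset (Fin n)) (χ₁ χ₂ : Fin n → Finset ℕ)
    (Fx : Fin n → Finset (V × V)) : Prop :=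
  (∀ i ∈ A, ∀ j ∈ A, i ≠ j → χ₁ i ∩ χ₁ j = ∅) ∧
  (∀ i ∈ A, ∀ j ∈ A, i ≠ j → χ₂ i ∩ χ₂ j = ∅) ∧
  (∀ i ∈ A, ∀ j ∈ A, i ≤ j → χ₁ i ∩ χ₂ j = ∅) ∧
  (∀ i ∈ A, N.IsRespecting c (χ₂ i) (xs i) (Fx i) ∧ χ₁ i = (Fx i).image c)

end PhyloNetwork

/-- A food web: a finite DAG on the taxa, with rational edge weights in `[0,1]`,
edges directed from prey to predator. -/
structure FoodWeb (V : Type*) [Fintype V] [DecidableEq V] where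
  E : Finset (V × V)
  γ : V × V → ℚ
  γ_range : ∀ e ∈ E, 0 ≤ γ e ∧ γ e ≤ 1
  acyclic : ∀ v : V, ¬ Relation.TransGen (fun a b : V => (a, b) ∈ E) v v

/-- A set `A` of taxa is `γ`-viable: every non-source member of `A` receives a total
incoming edge weight of at least `1` from members of `A`. -/
def FoodWeb.Viable {V : Type*} [Fintype V] [DecidableEq V] (W : FoodWeb V)
    (A : Set V) : Prop :=
  ∀ x ∈ A, (∃ e ∈ W.E, e.2 = x) →
    1 ≤ ∑ e ∈ W.E.filter (fun e => e.2 = x ∧ e.1 ∈ A), W.γ e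

theorem mem_edgesTo_aux {V : Type*} [Fintype V] [DecidableEq V] (N : PhyloNetwork V) (S : Set V)
    (e : V × V) (he : e ∈ N.E) (h : ∃ x ∈ N.off e.2, x ∈ S) : e ∈ N.edgesTo S := by
  unfold PhyloNetwork.edgesTo
  rw [Finset.mem_filter]
  exact ⟨he, h⟩

theorem sum_biUnion_le_aux {ι α : Type*} [DecidableEq α] (A : Finset ι) (F : ι → Finset α)
    (w : α → ℕ) : ∑ e ∈ A.biUnion F, w e ≤ ∑ i ∈ A, ∑ e ∈ F i, w e := by
  induction A using Finset.induction_on with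
  | empty => simp
  | insert a s ha ih =>
    rw [Finset.biUnion_insert, Finset.sum_insert ha]
    have := Finset.sum_union_inter (s₁ := F a) (s₂ := s.biUnion F) (f := w)
    omega

theorem lost_edge_covered {V : Type*} [Fintype V] [DecidableEq V]
    (N : PhyloNetwork V) (c : V × V → ℕ)
    {n : ℕ} (xs : Fin n → V)
    (A : Finset (Fin n)) (χ₁ χ₂ : Fin n → Finset ℕ)
    (Fx : Fin n → Finset (V × V))
    (hperf : N.IsPerfect c xs A χ₁ χ₂ Fx) (v : V)
    (hv : ∀ x ∈ N.off v, ∃ i ∈ A, xs i = x) :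
    ∀ e ∈ N.E, e.2 = v → ∃ i ∈ A, e ∈ Fx i := by
  have hwf : WellFounded (fun a b : V => Relation.TransGen (fun a b : V => (a, b) ∈ N.E) b a) := by
    haveI : IsTrans V (fun a b : V => Relation.TransGen (fun a b : V => (a, b) ∈ N.E) b a) :=
      ⟨fun a b c h1 h2 => h2.trans h1⟩
    haveI : Std.Irrefl (fun a b : V => Relation.TransGen (fun a b : V => (a, b) ∈ N.E) b a) :=
      ⟨fun a h => N.acyclic a h⟩
    exact Finite.wellFounded_of_trans_of_irrefl _
  obtain ⟨-, -, h12, hresp⟩ := hperf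
  induction v using hwf.induction with
  | _ v ih =>
  intro e he hev
  by_cases hleaf : N.IsLeaf v
  · obtain ⟨i, hi, hx⟩ := hv v ⟨hleaf, Relation.ReflTransGen.refl⟩
    exact ⟨i, hi, (hresp i hi).1.2.1 e he (hev.trans hx.symm)⟩
  have hcov : ∀ f ∈ N.E, f.1 = v → ∃ i ∈ A, f ∈ Fx i := by
    intro f hf hfv
    have hstep : (v, f.2) ∈ N.E := by rw [← hfv]; exact hf
    refine ih f.2 (Relation.TransGen.single hstep) ?_ f hf rfl
    intro x hx
    exact hv x ⟨hx.1, Relation.ReflTransGen.head hstep hx.2⟩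
  have hout : ∃ f ∈ N.E, f.1 = v := by
    have : 0 < (N.E.filter (fun e => e.1 = v)).card := by
      rcases N.classify v with h | h | h | h
      · exact absurd (hev.trans h) (N.root_indeg e he)
      · exact absurd h hleaf
      · omega
      · omega
    obtain ⟨f, hf⟩ := Finset.card_pos.mp this
    exact ⟨f, (Finset.mem_filter.mp hf).1, (Finset.mem_filter.mp hf).2⟩
  let I := A.filter (fun i => ∃ f ∈ Fx i, f.1 = v)
  have hI : I.Nonempty := by
    obtain ⟨f, hf, hfv⟩ := hout
    obtain ⟨i, hi, hfi⟩ := hcov f hf hfv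
    exact ⟨i, Finset.mem_filter.mpr ⟨hi, f, hfi, hfv⟩⟩
  obtain ⟨i, hiI, hmax⟩ := I.exists_max_image id hI
  obtain ⟨hi, f, hfi, hfv⟩ := Finset.mem_filter.mp hiI
  obtain ⟨F', hF'E, -, -, hx⟩ := (hresp i hi).1.2.2.2.2
  rcases hx f hfi with ⟨⟨h1, -⟩, -⟩ | ⟨⟨-, g, hg, hgv, hgc⟩, -⟩
  · exact ⟨i, hi, h1 e he (hev.trans hfv.symm)⟩
  · exfalso
    have hgv' := hgv.trans hfv
    obtain ⟨j, hj, hgj⟩ := hcov g (hF'E hg) hgv'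
    have hle : j ≤ i := hmax j (Finset.mem_filter.mpr ⟨hj, g, hgj, hgv'⟩)
    have hmem : c g ∈ χ₁ j ∩ χ₂ i := by
      rw [(hresp j hj).2]
      exact Finset.mem_inter.mpr ⟨Finset.mem_image_of_mem c hgj, hgc⟩
    rw [h12 j hj i hi hle] at hmem
    simp at hmem

/-- A perfect triple whose complement is viable, of large enough size and small
enough lost weight, yields a solution `S = X \ A` of the diversity problem. -/
theorem perfect_triple_solution {V : Type*} [Fintype V] [DecidableEq V]
    (N : PhyloNetwork V) (N₀ : ℕ) (c : V × V → ℕ)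
    (hc : ∀ e ∈ N.E, c e ∈ Finset.Icc 1 N₀)
    {n : ℕ} (xs : Fin n → V)
    (hxs_inj : Function.Injective xs)
    (hxs_leaf : ∀ i, N.IsLeaf (xs i))
    (hxs_surj : ∀ v : V, N.IsLeaf v → ∃ i, xs i = v)
    (W : FoodWeb V) (hW : ∀ e ∈ W.E, N.IsLeaf e.1 ∧ N.IsLeaf e.2)
    (k D : ℕ)
    (A : Finset (Fin n)) (χ₁ χ₂ : Fin n → Finset ℕ)
    (hχ : ∀ i ∈ A, χ₁ i ⊆ Finset.Icc 1 N₀ ∧ χ₂ i ⊆ Finset.Icc 1 N₀)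
    (Fx : Fin n → Finset (V × V))
    (hperf : N.IsPerfect c xs A χ₁ χ₂ Fx)
    (hviable : W.Viable {v : V | N.IsLeaf v ∧ ∀ i ∈ A, xs i ≠ v})
    (hcard : (Set.ncard {v : V | N.IsLeaf v} : ℤ) - (k : ℤ) ≤ (A.card : ℤ))
    (hweight : (∑ i ∈ A, (N.weight (Fx i) : ℤ)) ≤ (N.totalWeight : ℤ) - (D : ℤ)) :
    W.Viable {v : V | N.IsLeaf v ∧ ∀ i ∈ A, xs i ≠ v} ∧
    Set.ncard {v : V | N.IsLeaf v ∧ ∀ i ∈ A, xs i ≠ v} ≤ k ∧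
    D ≤ N.PD {v : V | N.IsLeaf v ∧ ∀ i ∈ A, xs i ≠ v} := by
  refine ⟨hviable, ?_, ?_⟩
  · have h1 : {v : V | N.IsLeaf v ∧ ∀ i ∈ A, xs i ≠ v}
        = {v : V | N.IsLeaf v} \ ((A.image xs : Finset V) : Set V) := by
      ext v; simp
    have hsub : ((A.image xs : Finset V) : Set V) ⊆ {v : V | N.IsLeaf v} := by
      intro v hv
      obtain ⟨i, -, rfl⟩ := Finset.mem_image.mp hv
      exact hxs_leaf i
    have h2 := Set.ncard_sdiff_add_ncard_of_subset hsub
    rw [Set.ncard_coe_finset, Finset.card_image_of_injective A hxs_inj] at h2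
    rw [h1]
    omega
  · set S : Set V := {v : V | N.IsLeaf v ∧ ∀ i ∈ A, xs i ≠ v} with hS
    have hsub : N.E ⊆ N.edgesTo S ∪ A.biUnion Fx := by
      intro e he
      by_cases h : ∃ x ∈ N.off e.2, x ∈ S
      · apply Finset.mem_union_left
        exact mem_edgesTo_aux N S e he h
      · apply Finset.mem_union_right
        rw [Finset.mem_biUnion]
        refine lost_edge_covered N c xs A χ₁ χ₂ Fx hperf e.2 ?_ e he rfl
        intro x hx
        by_contra hcon
        push Not at hcon
        exact h ⟨x, hx, hx.1, hcon⟩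
    have hle : N.totalWeight ≤ N.PD S + ∑ i ∈ A, N.weight (Fx i) := by
      unfold PhyloNetwork.totalWeight PhyloNetwork.PD PhyloNetwork.weight
      calc ∑ e ∈ N.E, N.ω e ≤ ∑ e ∈ N.edgesTo S ∪ A.biUnion Fx, N.ω e :=
            Finset.sum_le_sum_of_subset hsub
        _ ≤ ∑ e ∈ N.edgesTo S, N.ω e + ∑ e ∈ A.biUnion Fx, N.ω e := by
            rw [← Finset.sum_union_inter]; exact Nat.le_add_right _ _
        _ ≤ _ := by
            gcongr
            exact sum_biUnion_le_aux A Fx N.ω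
    have h3 : ((∑ i ∈ A, N.weight (Fx i) : ℕ) : ℤ) = ∑ i ∈ A, (N.weight (Fx i) : ℤ) := by
      push_cast; rfl
    omega
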